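/- arXiv:2008.02249 — 5 statements merged into one kernel-verified Lean document; each statement's English description precedes it below -/
import Mathlib

section
/- Let X be a metric space and γ an isometry of X. Let ℓ₀, ℓ₁ > 0 and let c₀, c₁ : ℝ → X be geodesic lines such that cᵢ(t + ℓᵢ) = γ(cᵢ(t)) for all t ∈ ℝ and i = 0, 1 (i.e., c₀ is an axis of γ with translation length ℓ₀ and c₁ is an axis of γ with translation length ℓ₁). If sup_{t ≥ 0} d(c₀(t), c₁(t)) < ∞, then ℓ₀ = ℓ₁. -/
/-- A curve that `γ` translates by `ℓ` is translated by `n * ℓ` under the `n`-th iterate of `γ`. -/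
theorem iterate_apply_zero_of_translate {X : Type*} {γ : X → X} {c : ℝ → X} {ℓ : ℝ}
    (h : ∀ t : ℝ, c (t + ℓ) = γ (c t)) (n : ℕ) : γ^[n] (c 0) = c (n * ℓ) := by
  induction n with
  | zero => simp
  | succ n ih =>
    rw [Function.iterate_succ_apply', ih, ← h]
    congr 1
    push_cast
    ring

theorem isometry_iterate {X : Type*} [PseudoEMetricSpace X] {γ : X → X} (hγ : Isometry γ) (n : ℕ) :
    Isometry γ^[n] := by
  induction n with
  | zero => exact isometry_id
  | succ n ih => exact ih.comp hγ

/-- Two axes of the same isometry that stay at bounded distance on `[0, ∞)`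
have the same translation length. -/
theorem two_axes_same_translation_length
    {X : Type*} [MetricSpace X] (γ : X → X) (hγ : Isometry γ)
    (ℓ₀ ℓ₁ : ℝ) (hℓ₀ : 0 < ℓ₀) (hℓ₁ : 0 < ℓ₁)
    (c₀ c₁ : ℝ → X)
    (hc₀ : ∀ s t : ℝ, dist (c₀ s) (c₀ t) = |s - t|)
    (hc₁ : ∀ s t : ℝ, dist (c₁ s) (c₁ t) = |s - t|)
    (haxis₀ : ∀ t : ℝ, c₀ (t + ℓ₀) = γ (c₀ t))
    (haxis₁ : ∀ t : ℝ, c₁ (t + ℓ₁) = γ (c₁ t))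
    (C : ℝ) (hC : ∀ t : ℝ, 0 ≤ t → dist (c₀ t) (c₁ t) ≤ C) :
    ℓ₀ = ℓ₁ := by
  have bound (n : ℕ) : n * |ℓ₀ - ℓ₁| ≤ 2 * C := by
    have hiter : dist (c₀ (n * ℓ₀)) (c₁ (n * ℓ₁)) ≤ C := by
      rw [← iterate_apply_zero_of_translate haxis₀, ← iterate_apply_zero_of_translate haxis₁,
        (isometry_iterate hγ n).dist_eq]
      exact hC 0 le_rfl
    have hdist : dist (c₀ (n * ℓ₀)) (c₁ (n * ℓ₀)) ≤ C := hC _ (by positivity)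
    calc n * |ℓ₀ - ℓ₁| = dist (c₁ (n * ℓ₀)) (c₁ (n * ℓ₁)) := by
          rw [hc₁, ← mul_sub, abs_mul, Nat.abs_cast]
      _ ≤ dist (c₀ (n * ℓ₀)) (c₁ (n * ℓ₀)) + dist (c₀ (n * ℓ₀)) (c₁ (n * ℓ₁)) :=
          dist_triangle_left _ _ _
      _ ≤ 2 * C := by linarith
  by_contra hne
  obtain ⟨n, hn⟩ := exists_nat_gt (2 * C / |ℓ₀ - ℓ₁|)
  rw [div_lt_iff₀ (abs_pos.mpr (sub_ne_zero.mpr hne))] at hn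
  exact (bound n).not_gt hn
end

section
/- Let X be a metric space and γ an isometry of X admitting an axis c with translation length ℓ > 0. Then for every p ∈ X, the limit lim_{t→∞} (d(γ(p), c(−t)) − d(p, c(−t))) exists and equals ℓ. In other words, the two-point Busemann function of the reversed ray t ↦ c(−t) satisfies b(γ(p), p) = ℓ for every p ∈ X. -/
open Filter Topology

/-- The Busemann function of the reversed ray of a geodesic line exists as a limit. -/
theorem exists_tendsto_dist_geodesic_sub {X : Type*} [PseudoMetricSpace X] (c : ℝ → X)
    (hc : ∀ s t : ℝ, dist (c s) (c t) = |s - t|) (p : X) :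
    ∃ b : ℝ, Tendsto (fun t : ℝ => dist p (c (-t)) - t) atTop (𝓝 b) := by
  refine ⟨_, tendsto_atTop_ciInf ?_ ⟨-dist p (c 0), ?_⟩⟩
  · intro s t hst
    have h := dist_triangle p (c (-s)) (c (-t))
    rw [hc, abs_of_nonneg (by linarith)] at h
    dsimp only
    linarith
  · rintro _ ⟨t, rfl⟩
    have h := dist_triangle_left (c 0) (c (-t)) p
    rw [hc] at h
    have h' := le_abs_self (0 - -t)
    dsimp only
    linarith

/-- If `c` is an axis of the isometry `γ` with translation length `ℓ > 0`, then
the two-point Busemann function of the reversed ray `t ↦ c(−t)`, evaluated at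
`(γ p, p)`, equals `ℓ` for every `p`. -/
theorem busemann_of_axis_eq_translation_length
    {X : Type*} [MetricSpace X] (γ : X → X) (hγ : Isometry γ)
    (ℓ : ℝ) (hℓ : 0 < ℓ)
    (c : ℝ → X)
    (hc : ∀ s t : ℝ, dist (c s) (c t) = |s - t|)
    (haxis : ∀ t : ℝ, c (t + ℓ) = γ (c t)) :
    ∀ p : X,
      Tendsto (fun t : ℝ => dist (γ p) (c (-t)) - dist p (c (-t)))
        atTop (𝓝 ℓ) := by
  intro p
  obtain ⟨b, hb⟩ := exists_tendsto_dist_geodesic_sub c hc p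
  have hshift := hb.comp (tendsto_atTop_add_const_right atTop ℓ tendsto_id)
  have hlim := (hshift.sub hb).add_const ℓ
  rw [sub_self, zero_add] at hlim
  refine hlim.congr fun t => ?_
  have h : c (-t) = γ (c (-(t + ℓ))) := by
    rw [← haxis]
    congr 1
    ring
  have hd : dist (γ p) (c (-t)) = dist p (c (-(t + ℓ))) := by
    rw [h, hγ.dist_eq]
  rw [hd]
  simp only [Function.comp_apply, id_eq]
  ring
end

section
/- Let X be a nonempty proper metric space and Γ a group acting on X by isometries such that the action is properly discontinuous (for all compact K, L ⊆ X the set {γ ∈ Γ : (γ • K) ∩ L ≠ ∅} is finite) and cocompact (there is a compact set K ⊆ X with ⋃_{γ ∈ Γ} γ • K = X). Then for every γ ∈ Γ the displacement infimum |γ| := inf_{q ∈ X} d(q, γ • q) is attained: there exists q₀ ∈ X with d(q₀, γ • q₀) = |γ|. -/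
open Pointwise

/-- Conjugate elements have the same displacement at corresponding points. -/
theorem dist_smul_mul_smul_eq_of_conj {X Γ : Type*} [MetricSpace X] [Group Γ] [MulAction Γ X]
    (hiso : ∀ γ : Γ, Isometry fun x : X => γ • x) (γ g : Γ) (x : X) :
    dist (g • x) (γ • g • x) = dist x ((g⁻¹ * γ * g) • x) := by
  rw [← (hiso g).dist_eq x]
  simp only [smul_smul, mul_assoc, mul_inv_cancel_left]

/-- A bounded-displacement set for `γ` is covered, up to points of equal displacement,
by a compact set. -/
theorem exists_isCompact_displacement_eq {X Γ : Type*} [MetricSpace X] [ProperSpace X]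
    [Group Γ] [MulAction Γ X]
    (hiso : ∀ γ : Γ, Isometry fun x : X => γ • x)
    (hpd : ∀ K L : Set X, IsCompact K → IsCompact L →
      {γ : Γ | ((γ • K) ∩ L).Nonempty}.Finite)
    (hcc : ∃ K : Set X, IsCompact K ∧ ⋃ γ : Γ, γ • K = Set.univ) (γ : Γ) (R : ℝ) :
    ∃ C : Set X, IsCompact C ∧ ∀ q : X, dist q (γ • q) ≤ R →
      ∃ q' ∈ C, dist q' (γ • q') = dist q (γ • q) := by
  obtain ⟨K, hK, hcov⟩ := hcc
  let φ : Γ → Γ := fun g => g⁻¹ * γ * g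
  let A : Set Γ := {g | ∃ k ∈ K, dist k (φ g • k) ≤ R}
  have hfin : (φ '' A).Finite := by
    refine (hpd K (Metric.cthickening R K) hK hK.cthickening).subset ?_
    rintro _ ⟨g, ⟨k, hk, hkR⟩, rfl⟩
    refine ⟨φ g • k, Set.smul_mem_smul_set hk, ?_⟩
    exact Metric.mem_cthickening_of_dist_le _ k R K hk (by rwa [dist_comm])
  obtain ⟨B, -, hB⟩ := Set.exists_subset_bijOn A φ
  have hBfin : B.Finite := hB.finite_iff_finite.2 hfin
  refine ⟨⋃ g ∈ B, (fun x => g • x) '' K,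
    hBfin.isCompact_biUnion fun g _ => hK.image (hiso g).continuous, fun q hq => ?_⟩
  obtain ⟨g, k, hk, rfl⟩ : ∃ g : Γ, ∃ k ∈ K, g • k = q := by
    simpa [Set.mem_smul_set] using hcov.ge (Set.mem_univ q)
  rw [dist_smul_mul_smul_eq_of_conj hiso] at hq ⊢
  obtain ⟨b, hb, hbg⟩ := hB.surjOn (Set.mem_image_of_mem φ (show g ∈ A from ⟨k, hk, hq⟩))
  refine ⟨b • k, Set.mem_biUnion hb ⟨k, hk, rfl⟩, ?_⟩
  rw [dist_smul_mul_smul_eq_of_conj hiso]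
  exact congrArg (fun h : Γ => dist k (h • k)) hbg

/-- For a properly discontinuous, cocompact action by isometries of a group `Γ`
on a nonempty proper metric space `X`, the displacement infimum
`|γ| = inf_q d(q, γ • q)` is attained for every `γ ∈ Γ`. -/
theorem displacement_infimum_attained
    {X : Type*} [MetricSpace X] [ProperSpace X] [Nonempty X]
    {Γ : Type*} [Group Γ] [MulAction Γ X]
    (hiso : ∀ γ : Γ, Isometry fun x : X => γ • x)
    (hpd : ∀ K L : Set X, IsCompact K → IsCompact L →
      {γ : Γ | ((γ • K) ∩ L).Nonempty}.Finite)
    (hcc : ∃ K : Set X, IsCompact K ∧ ⋃ γ : Γ, γ • K = Set.univ) :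
    ∀ γ : Γ, ∃ q₀ : X,
      dist q₀ (γ • q₀) = sInf (Set.range fun q : X => dist q (γ • q)) := by
  intro γ
  obtain ⟨x₀⟩ := ‹Nonempty X›
  obtain ⟨C, hC, hCq⟩ :=
    exists_isCompact_displacement_eq hiso hpd hcc γ (dist x₀ (γ • x₀))
  obtain ⟨x₁, hx₁, hx₁eq⟩ := hCq x₀ le_rfl
  obtain ⟨q₀, -, hmin⟩ := hC.exists_isMinOn ⟨x₁, hx₁⟩
    (continuous_id.dist (hiso γ).continuous).continuousOn
  refine ⟨q₀, Eq.symm (IsLeast.csInf_eq ?_)⟩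
  refine ⟨Set.mem_range_self q₀, ?_⟩
  rintro _ ⟨q, rfl⟩
  rcases le_total (dist q (γ • q)) (dist x₀ (γ • x₀)) with hq | hq
  · obtain ⟨q', hq', hq'eq⟩ := hCq q hq
    exact (hmin hq').trans_eq hq'eq
  · exact ((hmin hx₁).trans_eq hx₁eq).trans hq
end

section
/- For all real numbers h > 0 and 0 < b ≤ T, one has (1 − 1/(hb)) · ∫_b^T (e^{ht}/t) dt ≤ e^{hT}/(hT). -/
/-- Integration-by-parts upper bound:
`(1 − 1/(hb)) · ∫_b^T e^{ht}/t dt ≤ e^{hT}/(hT)` for `h > 0` and `0 < b ≤ T`. -/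
theorem integral_exp_div_upper_bound
    (h b T : ℝ) (hh : 0 < h) (hb : 0 < b) (hbT : b ≤ T) :
    (1 - 1 / (h * b)) * ∫ t in b..T, Real.exp (h * t) / t
      ≤ Real.exp (h * T) / (h * T) := by
  have hpos : ∀ t ∈ Set.uIcc b T, 0 < t := fun t ht => by
    rw [Set.uIcc_of_le hbT] at ht
    exact hb.trans_le ht.1
  have hderiv : ∀ t ∈ Set.uIcc b T, HasDerivAt (fun t => Real.exp (h * t) / (h * t))
      ((1 - 1 / (h * t)) * (Real.exp (h * t) / t)) t := fun t ht => by
    have ht0 := hpos t ht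
    have hlin : HasDerivAt (fun t => h * t) h t := by
      simpa using (hasDerivAt_id t).const_mul h
    refine (hlin.exp.div hlin (by positivity)).congr_deriv ?_
    field_simp
  have hint : IntervalIntegrable (fun t => Real.exp (h * t) / t) MeasureTheory.volume b T := by
    refine ContinuousOn.intervalIntegrable (ContinuousOn.div (by fun_prop) (by fun_prop) ?_)
    exact fun t ht => (hpos t ht).ne'
  have hint' : IntervalIntegrable (fun t => (1 - 1 / (h * t)) * (Real.exp (h * t) / t))
      MeasureTheory.volume b T := by
    refine hint.continuousOn_mul
      (continuousOn_const.sub (continuousOn_const.div (by fun_prop) ?_))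
    exact fun t ht => (mul_pos hh (hpos t ht)).ne'
  have hFTC := intervalIntegral.integral_eq_sub_of_hasDerivAt hderiv hint'
  have hb0 : 0 ≤ Real.exp (h * b) / (h * b) := by positivity
  rw [← intervalIntegral.integral_const_mul]
  calc ∫ t in b..T, (1 - 1 / (h * b)) * (Real.exp (h * t) / t)
      ≤ ∫ t in b..T, (1 - 1 / (h * t)) * (Real.exp (h * t) / t) := by
        refine intervalIntegral.integral_mono_on hbT (hint.const_mul _) hint' fun t ht => ?_
        have ht0 : 0 < t := hb.trans_le ht.1
        have hbt := ht.1
        gcongr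
    _ ≤ Real.exp (h * T) / (h * T) := by rw [hFTC]; linarith
end

section
/- For all real numbers h > 0 and b > 0, lim_{T→∞} (hT · e^{−hT} · ∫_b^T (e^{ht}/t) dt) = 1; that is, ∫_b^T (e^{ht}/t) dt is asymptotic to e^{hT}/(hT) as T → ∞. -/
open Filter Topology

lemma hasDerivAt_exp_mul_div (h : ℝ) {t : ℝ} (ht : t ≠ 0) :
    HasDerivAt (fun t : ℝ => Real.exp (h * t) / t)
      (h * (Real.exp (h * t) / t) - Real.exp (h * t) / t ^ 2) t := by
  have he : HasDerivAt (fun t : ℝ => Real.exp (h * t)) (Real.exp (h * t) * (h * 1)) t :=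
    ((hasDerivAt_id t).const_mul h).exp
  refine (he.div (hasDerivAt_id' t) ht).congr_deriv ?_
  field_simp

lemma hasDerivAt_exp_mul_div_sq (h : ℝ) {t : ℝ} (ht : t ≠ 0) :
    HasDerivAt (fun t : ℝ => Real.exp (h * t) / t ^ 2)
      (h * (Real.exp (h * t) / t ^ 2) - 2 * (Real.exp (h * t) / t ^ 3)) t := by
  have he : HasDerivAt (fun t : ℝ => Real.exp (h * t)) (Real.exp (h * t) * (h * 1)) t :=
    ((hasDerivAt_id t).const_mul h).exp
  refine (he.div (hasDerivAt_pow 2 t) (pow_ne_zero 2 ht)).congr_deriv ?_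
  field_simp
  norm_num
  ring

lemma continuousOn_exp_mul_div (h : ℝ) {a T : ℝ} (ha : 0 < a) :
    ContinuousOn (fun t : ℝ => Real.exp (h * t) / t) (Set.Icc a T) := fun _ ht =>
  (hasDerivAt_exp_mul_div h (ha.trans_le ht.1).ne').continuousAt.continuousWithinAt

lemma sub_le_integral_exp_mul_div {h a T : ℝ} (hh : 0 < h) (ha : 0 < a) (haT : a ≤ T) :
    Real.exp (h * T) / T / h - Real.exp (h * a) / a / h ≤
      ∫ t in a..T, Real.exp (h * t) / t := by
  refine intervalIntegral.sub_le_integral_of_hasDeriv_right_of_le haT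
    ((continuousOn_exp_mul_div h ha).div_const h)
    (fun t ht => ((hasDerivAt_exp_mul_div h (ha.trans ht.1).ne').div_const h).hasDerivWithinAt)
    ((continuousOn_exp_mul_div h ha).integrableOn_Icc) fun t ht => ?_
  have : 0 ≤ Real.exp (h * t) / t ^ 2 := by positivity
  rw [div_le_iff₀ hh]
  linarith

lemma integral_exp_mul_div_le_sub {h a T : ℝ} (hh : 0 < h) (ha : 4 / h ≤ a) (haT : a ≤ T) :
    ∫ t in a..T, Real.exp (h * t) / t ≤
      (Real.exp (h * T) / T / h + 2 / h ^ 2 * (Real.exp (h * T) / T ^ 2)) -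
        (Real.exp (h * a) / a / h + 2 / h ^ 2 * (Real.exp (h * a) / a ^ 2)) := by
  have ha0 : 0 < a := lt_of_lt_of_le (by positivity) ha
  have hd : ∀ t : ℝ, t ≠ 0 → HasDerivAt
      (fun t => Real.exp (h * t) / t / h + 2 / h ^ 2 * (Real.exp (h * t) / t ^ 2)) _ t :=
    fun t ht => ((hasDerivAt_exp_mul_div h ht).div_const h).add
      ((hasDerivAt_exp_mul_div_sq h ht).const_mul (2 / h ^ 2))
  refine intervalIntegral.integral_le_sub_of_hasDeriv_right_of_le haT
    (fun t ht => (hd t (ha0.trans_le ht.1).ne').continuousAt.continuousWithinAt)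
    (fun t ht => (hd t (ha0.trans ht.1).ne').hasDerivWithinAt)
    ((continuousOn_exp_mul_div h ha0).integrableOn_Icc) fun t ht => ?_
  have ht0 : 0 < t := ha0.trans ht.1
  have h4 : 0 ≤ h * t - 4 := by
    have := (div_le_iff₀' hh).1 (ha.trans ht.1.le)
    linarith
  have key : 0 ≤ Real.exp (h * t) * (h * t - 4) / (h ^ 2 * t ^ 3) := by positivity
  refine sub_nonneg.1 (key.trans_eq ?_)
  field_simp
  ring

/-- Asymptotics of the integral: for `h > 0` and `b > 0`,
`∫_b^T e^{ht}/t dt ∼ e^{hT}/(hT)` as `T → ∞`. -/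
theorem integral_exp_div_asymptotic
    (h b : ℝ) (hh : 0 < h) (hb : 0 < b) :
    Tendsto
      (fun T : ℝ => h * T * Real.exp (-(h * T)) * ∫ t in b..T, Real.exp (h * t) / t)
      atTop (𝓝 1) := by
  have hT : Tendsto (fun T : ℝ => h * T) atTop atTop := tendsto_id.const_mul_atTop hh
  have hdecay : Tendsto (fun T : ℝ => h * T * Real.exp (-(h * T))) atTop (𝓝 0) := by
    simpa [Function.comp_def] using (Real.tendsto_pow_mul_exp_neg_atTop_nhds_zero 1).comp hT
  have hinv : Tendsto (fun T : ℝ => 2 / (h * T)) atTop (𝓝 0) := hT.const_div_atTop 2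
  obtain ⟨a, hba, ha⟩ : ∃ a, b ≤ a ∧ 4 / h ≤ a := ⟨_, le_max_left _ _, le_max_right _ _⟩
  set C := Real.exp (h * b) / b / h
  set D := (∫ t in b..a, Real.exp (h * t) / t) -
    (Real.exp (h * a) / a / h + 2 / h ^ 2 * (Real.exp (h * a) / a ^ 2))
  have hlower : Tendsto (fun T : ℝ => 1 - h * T * Real.exp (-(h * T)) * C) atTop (𝓝 1) := by
    simpa using (hdecay.mul_const C).const_sub 1
  have hupper : Tendsto (fun T : ℝ => 1 + 2 / (h * T) + h * T * Real.exp (-(h * T)) * D)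
      atTop (𝓝 1) := by
    simpa using (hinv.const_add 1).add (hdecay.mul_const D)
  refine tendsto_of_tendsto_of_tendsto_of_le_of_le' hlower hupper ?_ ?_
  · filter_upwards [eventually_ge_atTop b] with T hbT
    have hT0 : 0 < T := hb.trans_le hbT
    calc 1 - h * T * Real.exp (-(h * T)) * C
        = h * T * Real.exp (-(h * T)) * (Real.exp (h * T) / T / h - C) := by
          rw [Real.exp_neg]
          field_simp
      _ ≤ _ := by
          gcongr
          exact sub_le_integral_exp_mul_div hh hb hbT
  · filter_upwards [eventually_ge_atTop a] with T haT
    have ha0 : 0 < a := hb.trans_le hba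
    have hT0 : 0 < T := ha0.trans_le haT
    have hle := integral_exp_mul_div_le_sub hh ha haT
    have hsplit := intervalIntegral.integral_add_adjacent_intervals
      ((continuousOn_exp_mul_div h hb).intervalIntegrable_of_Icc (μ := MeasureTheory.volume) hba)
      ((continuousOn_exp_mul_div h ha0).intervalIntegrable_of_Icc haT)
    calc h * T * Real.exp (-(h * T)) * ∫ t in b..T, Real.exp (h * t) / t
        ≤ h * T * Real.exp (-(h * T)) *
          (Real.exp (h * T) / T / h + 2 / h ^ 2 * (Real.exp (h * T) / T ^ 2) + D) := by
          gcongr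
          linarith
      _ = _ := by
          rw [Real.exp_neg]
          field_simp
end
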